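/- arXiv:2403.03543 — 9 statements merged into one kernel-verified Lean document; each statement's English description precedes it below -/
import Mathlib

section
/- Let P be a positive semidefinite matrix of size Nd × Nd, viewed as an N × N array of d × d blocks P_{ij}, and let ω be a vector in the unit simplex of R^N with ω_i > 0 for every i. Then P ⪯ D, where D is the block-diagonal matrix of size Nd × Nd whose i-th diagonal block is ω_i^{-1} P_{ii}; that is, D − P is positive semidefinite. -/
open Matrix

/-- The `Nd × d` matrix `1_N ⊗ I_d`: the vertical stack of `N` copies of `I_d`. -/
noncomputable def Hstack (d N : ℕ) : Matrix (Fin d × Fin N) (Fin d) ℝ :=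
  fun p l => if p.1 = l then 1 else 0

/-- Convexity of the quadratic form of a positive semidefinite matrix, in weighted form. -/
theorem Matrix.PosSemidef.dotProduct_mulVec_sum_le {n ι : Type*} [Fintype n] [Fintype ι]
    {P : Matrix n n ℝ} (hP : P.PosSemidef) {w : ι → ℝ} (hw : ∀ i, 0 < w i) (hsum : ∑ i, w i = 1)
    (v : ι → n → ℝ) :
    (∑ i, v i) ⬝ᵥ (P *ᵥ ∑ i, v i) ≤ ∑ i, (w i)⁻¹ * (v i ⬝ᵥ (P *ᵥ v i)) := by
  classical
  obtain ⟨B, rfl⟩ : ∃ B : Matrix n n ℝ, P = Bᴴ * B := by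
    open scoped MatrixOrder in
    exact CStarAlgebra.nonneg_iff_eq_star_mul_self.mp hP.nonneg
  have key (y : n → ℝ) : y ⬝ᵥ ((Bᴴ * B) *ᵥ y) = ∑ m, (B *ᵥ y) m ^ 2 := by
    rw [← mulVec_mulVec, dotProduct_mulVec, conjTranspose_eq_transpose_of_trivial,
      vecMul_transpose]
    simp [dotProduct, sq]
  simp only [key]
  simp only [mulVec_sum, Finset.sum_apply, Finset.mul_sum]
  rw [Finset.sum_comm]
  refine Finset.sum_le_sum fun m _ => ?_
  have h := Finset.sq_sum_div_le_sum_sq_div Finset.univ (fun i => (B *ᵥ v i) m)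
    (fun i _ => hw i)
  rw [hsum, div_one] at h
  simpa only [div_eq_inv_mul] using h

/-- A positive semidefinite `Nd × Nd` matrix is dominated (in the Loewner order) by the
block-diagonal matrix whose `i`-th diagonal block is `ω i⁻¹` times its `i`-th diagonal block,
for any `ω` in the interior of the unit simplex. -/
theorem blockDiagonal_bound {d N : ℕ} (hd : 1 ≤ d) (hN : 1 ≤ N)
    (P : Matrix (Fin d × Fin N) (Fin d × Fin N) ℝ) (hP : P.PosSemidef)
    (ω : Fin N → ℝ) (hω : ∀ i, 0 < ω i) (hsum : ∑ i, ω i = 1) :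
    (Matrix.blockDiagonal
        (fun i => (ω i)⁻¹ • (fun k l => P (k, i) (l, i) : Matrix (Fin d) (Fin d) ℝ))
      - P).PosSemidef := by
  have hD (k l : Fin d) (i j : Fin N) : Matrix.blockDiagonal
        (fun i => (ω i)⁻¹ • (fun k l => P (k, i) (l, i) : Matrix (Fin d) (Fin d) ℝ)) (k, i) (l, j)
      = if i = j then (ω i)⁻¹ * P (k, i) (l, i) else 0 := blockDiagonal_apply _ _ _
  refine .of_dotProduct_mulVec_nonneg (.sub ?_ hP.isHermitian) fun x => ?_
  · ext ⟨k, i⟩ ⟨l, j⟩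
    rw [conjTranspose_apply, star_trivial, hD, hD]
    rcases eq_or_ne i j with rfl | hij
    · simpa using Or.inl (hP.isHermitian.apply (k, i) (l, i))
    · simp [hij, hij.symm]
  · let v : Fin N → Fin d × Fin N → ℝ := fun i p => if p.2 = i then x p else 0
    have hv : ∑ i, v i = x := by
      ext p
      simp [v]
    have h := hP.dotProduct_mulVec_sum_le hω hsum v
    rw [hv] at h
    rw [star_trivial, sub_mulVec, dotProduct_sub, sub_nonneg]
    refine h.trans_eq ?_
    simp only [v, dotProduct, mulVec, hD, Fintype.sum_prod_type_right,
      ite_mul, mul_ite, zero_mul, mul_zero, Finset.sum_ite_irrel,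
      Finset.sum_const_zero, Finset.sum_ite_eq, Finset.sum_ite_eq', Finset.mem_univ, if_true,
      Finset.mul_sum]
    refine Finset.sum_congr rfl fun i _ => Finset.sum_congr rfl fun k _ =>
      Finset.sum_congr rfl fun l _ => ?_
    ring
end

section
/- Conservativeness of the Extended Split Covariance Intersection fusion. Let ω lie in the unit simplex of R^N with ω_i > 0 for all i, let P_1^{(1)}, …, P_N^{(1)} be positive definite d × d matrices, and let P^{(2)} be a positive semidefinite Nd × Nd matrix. Set B_cent = diag(ω_1^{-1} P_1^{(1)}, …, ω_N^{-1} P_N^{(1)}) + P^{(2)} (a positive definite Nd × Nd matrix), B_F = (Hᵀ B_cent^{-1} H)^{-1}, and K = B_F Hᵀ B_cent^{-1} ∈ R^{d × Nd}. Then for every positive semidefinite Nd × Nd matrix P^{(1)} whose i-th diagonal d × d block equals P_i^{(1)} for every i, one has K (P^{(1)} + P^{(2)}) Kᵀ ⪯ B_F. -/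
open Matrix

theorem Matrix.nonsing_inv_mul_self_mul_nonsing_inv {n R : Type*} [Fintype n] [DecidableEq n]
    [CommRing R] (A : Matrix n n R) : A⁻¹ * A * A⁻¹ = A⁻¹ := by
  by_cases h : IsUnit A.det
  · rw [nonsing_inv_mul A h, one_mul]
  · simp [nonsing_inv_apply_not_isUnit A h]

theorem Matrix.dotProduct_blockDiagonal_mulVec {m o R : Type*} [Fintype m] [Fintype o]
    [DecidableEq o] [CommSemiring R] (M : o → Matrix m m R) (x y : m × o → R) :
    x ⬝ᵥ blockDiagonal M *ᵥ y = ∑ i, (fun k => x (k, i)) ⬝ᵥ M i *ᵥ (fun k => y (k, i)) := by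
  simp only [dotProduct, mulVec, Fintype.sum_prod_type, blockDiagonal_apply, ite_mul, zero_mul,
    Finset.sum_ite_eq, Finset.mem_univ, if_true]
  exact Finset.sum_comm

theorem Matrix.dotProduct_conjTranspose_mul_self_mulVec {m n : Type*} [Fintype m] [Fintype n]
    (C : Matrix m n ℝ) (x : n → ℝ) : x ⬝ᵥ (Cᴴ * C) *ᵥ x = ∑ p, (C *ᵥ x) p ^ 2 := by
  rw [← mulVec_mulVec, dotProduct_mulVec, conjTranspose_eq_transpose_of_trivial, vecMul_transpose]
  simp only [dotProduct, sq]

/-- A positive semidefinite matrix is dominated by the block-diagonal matrix of its diagonal blocks,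
each inflated by the inverse of a weight, when the weights are positive and sum to one. -/
theorem Matrix.PosSemidef.blockDiagonal_inv_smul_sub {m o : Type*} [Fintype m] [Fintype o]
    [DecidableEq o] {P : Matrix (m × o) (m × o) ℝ} (hP : P.PosSemidef)
    {ω : o → ℝ} (hω : ∀ i, 0 < ω i) (hsum : ∑ i, ω i = 1) :
    (blockDiagonal (fun i => (ω i)⁻¹ • P.submatrix (·, i) (·, i)) - P).PosSemidef := by
  classical
  refine .of_dotProduct_mulVec_nonneg (.sub ?_ hP.isHermitian) fun x => ?_
  · rw [IsHermitian, blockDiagonal_conjTranspose]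
    congr 1
    ext1 i
    rw [conjTranspose_smul, star_trivial, conjTranspose_submatrix, hP.isHermitian.eq]
  obtain ⟨C, rfl⟩ : ∃ C : Matrix (m × o) (m × o) ℝ, P = Cᴴ * C := by
    open scoped MatrixOrder in
    exact CStarAlgebra.nonneg_iff_eq_star_mul_self.mp hP.nonneg
  have hblock (i : o) : (Cᴴ * C).submatrix (·, i) (·, i)
      = (C.submatrix id (·, i))ᴴ * C.submatrix id (·, i) := rfl
  have hsplit (p : m × o) :
      (C *ᵥ x) p = ∑ i, (C.submatrix id (·, i) *ᵥ fun k => x (k, i)) p := by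
    simp only [mulVec, dotProduct, submatrix_apply, id, Fintype.sum_prod_type_right]
  rw [star_trivial, sub_mulVec, dotProduct_sub, sub_nonneg, dotProduct_blockDiagonal_mulVec,
    dotProduct_conjTranspose_mul_self_mulVec]
  simp only [hblock, smul_mulVec, dotProduct_smul, dotProduct_conjTranspose_mul_self_mulVec,
    smul_eq_mul, Finset.mul_sum, hsplit]
  rw [Finset.sum_comm]
  refine Finset.sum_le_sum fun p _ => ?_
  simpa [hsum, div_eq_inv_mul] using Finset.sq_sum_div_le_sum_sq_div Finset.univ
    (fun i => (C.submatrix id (·, i) *ᵥ fun k => x (k, i)) p) (g := ω) fun i _ => hω i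

/-- The generalized least squares gain `K = (Hᵀ B⁻¹ H)⁻¹ Hᵀ B⁻¹` satisfies
`K B Kᵀ = (Hᵀ B⁻¹ H)⁻¹`. -/
theorem Matrix.IsSymm.gain_mul_mul_gain_transpose {m n R : Type*} [Fintype m] [Fintype n]
    [DecidableEq m] [DecidableEq n] [CommRing R] {B : Matrix n n R} (hB : B.IsSymm)
    (H : Matrix n m R) :
    ((Hᵀ * B⁻¹ * H)⁻¹ * Hᵀ * B⁻¹) * B * ((Hᵀ * B⁻¹ * H)⁻¹ * Hᵀ * B⁻¹)ᵀ = (Hᵀ * B⁻¹ * H)⁻¹ := by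
  have hinv : B⁻¹ᵀ = B⁻¹ := by rw [transpose_nonsing_inv, hB.eq]
  have hS : (Hᵀ * B⁻¹ * H)⁻¹ᵀ = (Hᵀ * B⁻¹ * H)⁻¹ := by
    rw [transpose_nonsing_inv, transpose_mul, transpose_mul, hinv, transpose_transpose,
      Matrix.mul_assoc]
  calc _ = (Hᵀ * B⁻¹ * H)⁻¹ * (Hᵀ * (B⁻¹ * B * B⁻¹) * H) * (Hᵀ * B⁻¹ * H)⁻¹ := by
        rw [transpose_mul, transpose_mul, hinv, hS, transpose_transpose]
        simp only [Matrix.mul_assoc]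
    _ = _ := by
        rw [nonsing_inv_mul_self_mul_nonsing_inv, nonsing_inv_mul_self_mul_nonsing_inv]

/-- Conservativeness of the Extended Split Covariance Intersection fusion. -/
theorem ESCI_conservative {d N : ℕ} (hd : 1 ≤ d) (hN : 1 ≤ N)
    (ω : Fin N → ℝ) (hω : ∀ i, 0 < ω i) (hsum : ∑ i, ω i = 1)
    (P1 : Fin N → Matrix (Fin d) (Fin d) ℝ) (hP1 : ∀ i, (P1 i).PosDef)
    (P2 : Matrix (Fin d × Fin N) (Fin d × Fin N) ℝ) (hP2 : P2.PosSemidef) :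
    let Bcent := Matrix.blockDiagonal (fun i => (ω i)⁻¹ • P1 i) + P2
    let BF := ((Hstack d N)ᵀ * Bcent⁻¹ * Hstack d N)⁻¹
    let K := BF * (Hstack d N)ᵀ * Bcent⁻¹
    ∀ P1c : Matrix (Fin d × Fin N) (Fin d × Fin N) ℝ,
      P1c.PosSemidef → (∀ i k l, P1c (k, i) (l, i) = P1 i k l) →
      (BF - K * (P1c + P2) * Kᵀ).PosSemidef := by
  intro Bcent BF K P1c hP1c hdiag
  have hblocks : P1 = fun i => P1c.submatrix (·, i) (·, i) := by
    ext i k l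
    exact (hdiag i k l).symm
  have hdom : (Bcent - (P1c + P2)).PosSemidef := by
    simpa only [Bcent, hblocks, add_sub_add_right_eq_sub] using
      hP1c.blockDiagonal_inv_smul_sub hω hsum
  have hsymm : Bcent.IsSymm := by
    have h := hdom.isHermitian.add (hP1c.add hP2).isHermitian
    rwa [sub_add_cancel, IsHermitian, conjTranspose_eq_transpose_of_trivial] at h
  have hgain : K * Bcent * Kᵀ = BF := hsymm.gain_mul_mul_gain_transpose (Hstack d N)
  rw [← hgain, ← Matrix.sub_mul, ← Matrix.mul_sub]
  simpa only [conjTranspose_eq_transpose_of_trivial] using hdom.mul_mul_conjTranspose_same K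
end

section
/- Conservativeness of the Covariance Intersection fusion. Let ω lie in the unit simplex of R^N with ω_i > 0 for all i, and let P_1, …, P_N be positive definite d × d matrices. Set B_F = (∑_{i=1}^N ω_i P_i^{-1})^{-1} and K = [K_1 … K_N] ∈ R^{d × Nd} with K_i = B_F ω_i P_i^{-1}. Then ∑_{i=1}^N K_i = I_d, and for every positive semidefinite Nd × Nd matrix P whose i-th diagonal d × d block equals P_i for every i, one has K P Kᵀ ⪯ B_F. -/
open Matrix

/-- The weighted variance identity for the quadratic map `A ↦ A * Q * Aᵀ`. -/
theorem sum_smul_sub_mul_mul_transpose {ι m n : Type*} [Fintype ι] [Fintype n]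
    (ω : ι → ℝ) (hsum : ∑ i, ω i = 1) (G : ι → Matrix m n ℝ) (K : Matrix m n ℝ)
    (hK : ∑ i, ω i • G i = K) (Q : Matrix n n ℝ) :
    ∑ i, ω i • ((G i - K) * Q * (G i - K)ᵀ) = ∑ i, ω i • (G i * Q * (G i)ᵀ) - K * Q * Kᵀ := by
  have h1 : ∑ i, ω i • (G i * Q * Kᵀ) = K * Q * Kᵀ := by
    simp only [← hK, Matrix.sum_mul, Matrix.smul_mul]
  have h2 : ∑ i, ω i • (K * Q * (G i)ᵀ) = K * Q * Kᵀ := by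
    rw [← congrArg Matrix.transpose hK]
    simp only [Matrix.transpose_sum, Matrix.transpose_smul, Matrix.mul_sum, Matrix.mul_smul]
  have h3 : ∑ i, ω i • (K * Q * Kᵀ) = K * Q * Kᵀ := by
    rw [← Finset.sum_smul, hsum, one_smul]
  simp only [Matrix.transpose_sub, Matrix.sub_mul, Matrix.mul_sub, smul_sub,
    Finset.sum_sub_distrib, h1, h2, h3]
  abel

/-- The block row whose `i`-th block is `A` and whose other blocks vanish. -/
def blockRowSingle {m n ι : Type*} [DecidableEq ι] (i : ι) (A : Matrix m n ℝ) :
    Matrix m (n × ι) ℝ :=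
  Matrix.of fun k p => if p.2 = i then A k p.1 else 0

theorem blockRowSingle_mul_mul_transpose {m n ι : Type*} [Fintype n] [Fintype ι] [DecidableEq ι]
    (i : ι) (A : Matrix m n ℝ) (Q : Matrix (n × ι) (n × ι) ℝ) :
    blockRowSingle i A * Q * (blockRowSingle i A)ᵀ =
      A * Q.submatrix (fun k => (k, i)) (fun k => (k, i)) * Aᵀ := by
  ext k l
  simp [blockRowSingle, Matrix.mul_apply, Fintype.sum_prod_type]

/-- Conservativeness of the Covariance Intersection fusion. -/
theorem CI_conservative {d N : ℕ} (hd : 1 ≤ d) (hN : 1 ≤ N)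
    (ω : Fin N → ℝ) (hω : ∀ i, 0 < ω i) (hsum : ∑ i, ω i = 1)
    (P : Fin N → Matrix (Fin d) (Fin d) ℝ) (hP : ∀ i, (P i).PosDef) :
    let BF := (∑ i, ω i • (P i)⁻¹)⁻¹
    let K : Matrix (Fin d) (Fin d × Fin N) ℝ := fun k p => (ω p.2 • (BF * (P p.2)⁻¹)) k p.1
    (∑ i, ω i • (BF * (P i)⁻¹)) = 1 ∧
    ∀ Pc : Matrix (Fin d × Fin N) (Fin d × Fin N) ℝ,
      Pc.PosSemidef → (∀ i k l, Pc (k, i) (l, i) = P i k l) →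
      (BF - K * Pc * Kᵀ).PosSemidef := by
  intro BF K
  have hS : (∑ i, ω i • (P i)⁻¹).PosDef :=
    Matrix.posDef_sum ⟨⟨0, hN⟩, Finset.mem_univ _⟩ fun i _ => (hP i).inv.smul (hω i)
  have hunit : IsUnit (∑ i, ω i • (P i)⁻¹).det := (Matrix.isUnit_iff_isUnit_det _).mp hS.isUnit
  have hone : ∑ i, ω i • (BF * (P i)⁻¹) = 1 := by
    simp only [← Matrix.mul_smul, ← Matrix.mul_sum]
    exact Matrix.nonsing_inv_mul _ hunit
  refine ⟨hone, fun Pc hPc hblock => ?_⟩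
  have hBFt : BFᵀ = BF := hS.inv.isHermitian
  let G : Fin N → Matrix (Fin d) (Fin d × Fin N) ℝ := fun i => blockRowSingle i (BF * (P i)⁻¹)
  have hK : ∑ i, ω i • G i = K := by
    ext k p
    simp [G, K, blockRowSingle, Matrix.sum_apply]
  have hG (i : Fin N) : G i * Pc * (G i)ᵀ = BF * (P i)⁻¹ * BF := by
    have hsub : Pc.submatrix (fun k => (k, i)) (fun k => (k, i)) = P i := by
      ext k l
      exact hblock i k l
    have hPt : ((P i)⁻¹)ᵀ = (P i)⁻¹ := (hP i).inv.isHermitian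
    have hPu : IsUnit (P i).det := (Matrix.isUnit_iff_isUnit_det _).mp (hP i).isUnit
    rw [blockRowSingle_mul_mul_transpose, hsub, Matrix.transpose_mul, hPt, hBFt,
      Matrix.nonsing_inv_mul_cancel_right _ _ hPu, Matrix.mul_assoc]
  have hBF : ∑ i, ω i • (G i * Pc * (G i)ᵀ) = BF := by
    simp only [hG]
    calc ∑ i, ω i • (BF * (P i)⁻¹ * BF) = (∑ i, ω i • (BF * (P i)⁻¹)) * BF := by
          simp only [Matrix.sum_mul, Matrix.smul_mul]
      _ = BF := by rw [hone, Matrix.one_mul]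
  have hvar := sum_smul_sub_mul_mul_transpose ω hsum G K hK Pc
  rw [hBF] at hvar
  rw [← hvar]
  refine Matrix.posSemidef_sum _ fun i _ => ?_
  exact (hPc.mul_mul_conjTranspose_same (G i - K)).smul (hω i).le
end

section
/- Conservativeness of the Split Covariance Intersection fusion. Let ω lie in the unit simplex of R^N with ω_i > 0 for all i, let P_1^{(1)}, …, P_N^{(1)} be positive definite d × d matrices, and let P_1^{(2)}, …, P_N^{(2)} be positive semidefinite d × d matrices. Set P'_i = P_i^{(1)} + ω_i P_i^{(2)} (positive definite), B_F = (∑_{i=1}^N ω_i P'_i^{-1})^{-1}, and K = [K_1 … K_N] ∈ R^{d × Nd} with K_i = B_F ω_i P'_i^{-1}. Then for every positive semidefinite Nd × Nd matrix P^{(1)} whose i-th diagonal d × d block equals P_i^{(1)} for every i, one has K (P^{(1)} + diag(P_1^{(2)}, …, P_N^{(2)})) Kᵀ ⪯ B_F. -/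
open Matrix

namespace Matrix

variable {m n o : Type*} [Fintype n] [Fintype o] [DecidableEq o]

theorem dotProduct_blockDiagonal_mulVec_s6 (Q : o → Matrix n n ℝ) (x : n × o → ℝ) :
    x ⬝ᵥ (blockDiagonal Q *ᵥ x) =
      ∑ i, (fun k => x (k, i)) ⬝ᵥ (Q i *ᵥ fun k => x (k, i)) := by
  simp only [dotProduct, mulVec, blockDiagonal_apply, Fintype.sum_prod_type_right, ite_mul,
    zero_mul]
  simp

theorem mul_blockDiagonal_mul_transpose (L : o → Matrix m n ℝ) (Q : o → Matrix n n ℝ) :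
    (of fun k (p : n × o) => L p.2 k p.1) * blockDiagonal Q *
      (of fun k (p : n × o) => L p.2 k p.1)ᵀ = ∑ i, L i * Q i * (L i)ᵀ := by
  ext k l
  simp only [mul_apply, blockDiagonal_apply, Fintype.sum_prod_type_right, sum_apply, of_apply,
    transpose_apply, mul_ite, mul_zero]
  simp

theorem dotProduct_transpose_mul_self_mulVec [Fintype m] (A : Matrix m n ℝ) (x : n → ℝ) :
    x ⬝ᵥ ((Aᵀ * A) *ᵥ x) = ∑ r, (A *ᵥ x) r ^ 2 := by
  rw [← mulVec_mulVec, dotProduct_mulVec, vecMul_transpose]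
  simp only [dotProduct, sq]

open scoped MatrixOrder in
/-- A positive semidefinite block matrix is dominated by its block diagonal part, with the blocks
inflated by the inverses of positive weights summing to one. -/
theorem PosSemidef.blockDiagonal_inv_smul_sub_s6 [DecidableEq n] {M : Matrix (n × o) (n × o) ℝ}
    (hM : M.PosSemidef) {ω : o → ℝ} (hω : ∀ i, 0 < ω i) (hsum : ∑ i, ω i = 1)
    {Q : o → Matrix n n ℝ} (hQ : ∀ i k l, M (k, i) (l, i) = Q i k l) :
    (blockDiagonal (fun i => (ω i)⁻¹ • Q i) - M).PosSemidef := by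
  have hQ' : ∀ i, (Q i)ᵀ = Q i := fun i => by
    ext k l
    rw [transpose_apply, ← hQ, ← hQ]
    exact hM.isHermitian.apply _ _
  obtain ⟨A, hA⟩ : ∃ A : Matrix (n × o) (n × o) ℝ, M = Aᵀ * A := by
    obtain ⟨A, hA⟩ := CStarAlgebra.nonneg_iff_eq_star_mul_self.mp hM.nonneg
    exact ⟨A, by rw [hA, star_eq_conjTranspose, conjTranspose_eq_transpose_of_trivial]⟩
  refine PosSemidef.of_dotProduct_mulVec_nonneg (IsHermitian.sub ?_ hM.isHermitian) fun x => ?_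
  · rw [IsHermitian, conjTranspose_eq_transpose_of_trivial, blockDiagonal_transpose]
    simp only [transpose_smul, hQ']
  have hblock : ∀ i, Q i = (of fun r k => A r (k, i))ᵀ * (of fun r k => A r (k, i)) := fun i => by
    ext k l
    rw [← hQ, hA]
    simp [mul_apply]
  have hsplit : ∀ r, (A *ᵥ x) r =
      ∑ i, ((of fun r k => A r (k, i)) *ᵥ fun k => x (k, i)) r := fun r => by
    simp [mulVec, dotProduct, Fintype.sum_prod_type_right]
  rw [star_trivial, sub_mulVec, dotProduct_sub, sub_nonneg, dotProduct_blockDiagonal_mulVec_s6, hA,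
    dotProduct_transpose_mul_self_mulVec]
  simp only [smul_mulVec, dotProduct_smul, hblock, dotProduct_transpose_mul_self_mulVec, hsplit,
    smul_eq_mul, Finset.mul_sum]
  rw [Finset.sum_comm]
  refine Finset.sum_le_sum fun r _ => ?_
  have h := Finset.sq_sum_div_le_sum_sq_div Finset.univ
    (fun i => ((of fun r k => A r (k, i)) *ᵥ fun k => x (k, i)) r) (g := ω) fun i _ => hω i
  rw [hsum, div_one] at h
  simpa only [div_eq_inv_mul] using h

end Matrix

/-- Conservativeness of the Split Covariance Intersection fusion. -/
theorem SCI_conservative {d N : ℕ} (hd : 1 ≤ d) (hN : 1 ≤ N)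
    (ω : Fin N → ℝ) (hω : ∀ i, 0 < ω i) (hsum : ∑ i, ω i = 1)
    (P1 : Fin N → Matrix (Fin d) (Fin d) ℝ) (hP1 : ∀ i, (P1 i).PosDef)
    (P2 : Fin N → Matrix (Fin d) (Fin d) ℝ) (hP2 : ∀ i, (P2 i).PosSemidef) :
    let P' : Fin N → Matrix (Fin d) (Fin d) ℝ := fun i => P1 i + ω i • P2 i
    let BF := (∑ i, ω i • (P' i)⁻¹)⁻¹
    let K : Matrix (Fin d) (Fin d × Fin N) ℝ := fun k p => (ω p.2 • (BF * (P' p.2)⁻¹)) k p.1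
    ∀ P1c : Matrix (Fin d × Fin N) (Fin d × Fin N) ℝ,
      P1c.PosSemidef → (∀ i k l, P1c (k, i) (l, i) = P1 i k l) →
      (BF - K * (P1c + Matrix.blockDiagonal P2) * Kᵀ).PosSemidef := by
  intro P' BF K P1c hP1c hblock
  have hP' : ∀ i, (P' i).PosDef := fun i => (hP1 i).add_posSemidef ((hP2 i).smul (hω i).le)
  have : Nonempty (Fin N) := ⟨⟨0, hN⟩⟩
  have hS : (∑ i, ω i • (P' i)⁻¹).PosDef :=
    posDef_sum Finset.univ_nonempty fun i _ => (hP' i).inv.smul (hω i)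
  have hBF : BFᵀ = BF := hS.inv.isHermitian
  have hinv : ∀ i, ((P' i)⁻¹)ᵀ = (P' i)⁻¹ := fun i => (hP' i).inv.isHermitian
  have hterm : ∀ i, ω i • (BF * (P' i)⁻¹) * ((ω i)⁻¹ • P' i) * (ω i • (BF * (P' i)⁻¹))ᵀ =
      BF * (ω i • (P' i)⁻¹) * BF := fun i => by
    rw [transpose_smul, transpose_mul, hBF, hinv, smul_mul_smul_comm, mul_inv_cancel₀ (hω i).ne',
      one_smul, nonsing_inv_mul_cancel_right _ _ (isUnit_iff_isUnit_det _ |>.mp (hP' i).isUnit)]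
    simp only [smul_mul, mul_assoc]
  have hK : K * blockDiagonal (fun i => (ω i)⁻¹ • P' i) * Kᵀ = BF := by
    refine (mul_blockDiagonal_mul_transpose (fun i => ω i • (BF * (P' i)⁻¹)) _).trans ?_
    simp only [hterm]
    rw [← Finset.sum_mul, ← Finset.mul_sum,
      nonsing_inv_mul _ (isUnit_iff_isUnit_det _ |>.mp hS.isUnit), one_mul]
  have hD : blockDiagonal (fun i => (ω i)⁻¹ • P' i) =
      blockDiagonal (fun i => (ω i)⁻¹ • P1 i) + blockDiagonal P2 := by
    rw [← blockDiagonal_add]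
    congr 1
    ext1 i
    simp only [P', Pi.add_apply, smul_add, inv_smul_smul₀ (hω i).ne']
  have h := (hP1c.blockDiagonal_inv_smul_sub_s6 hω hsum hblock).mul_mul_conjTranspose_same K
  rw [conjTranspose_eq_transpose_of_trivial] at h
  convert h using 1
  rw [← hK, hD, ← Matrix.sub_mul, ← Matrix.mul_sub, add_sub_add_right_eq_sub]
end

section
/- ESCI reduces to SCI when the known component is block diagonal. Let ω ∈ R^N have ω_i > 0 for all i, let P_1^{(1)}, …, P_N^{(1)} be positive definite d × d matrices and P_1^{(2)}, …, P_N^{(2)} be positive semidefinite d × d matrices. Set B_cent = diag(ω_1^{-1} P_1^{(1)}, …, ω_N^{-1} P_N^{(1)}) + diag(P_1^{(2)}, …, P_N^{(2)}). Then Hᵀ B_cent^{-1} H = ∑_{i=1}^N ω_i (P_i^{(1)} + ω_i P_i^{(2)})^{-1}, and the i-th d × d block of the d × Nd matrix Hᵀ B_cent^{-1} equals ω_i (P_i^{(1)} + ω_i P_i^{(2)})^{-1}; consequently the ESCI fusion bound and gains coincide with those of the SCI fusion. -/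
open Matrix

theorem Matrix.inv_blockDiagonal_of_isUnit_det {m o R : Type*} [Fintype m] [DecidableEq m]
    [Fintype o] [DecidableEq o] [CommRing R] (M : o → Matrix m m R)
    (hM : ∀ i, IsUnit (M i).det) :
    (blockDiagonal M)⁻¹ = blockDiagonal (fun i => (M i)⁻¹) := by
  apply Matrix.inv_eq_right_inv
  rw [← blockDiagonal_mul]
  simp only [Matrix.mul_nonsing_inv _ (hM _)]
  exact blockDiagonal_one

theorem Matrix.PosDef.inv_inv_smul_add {n : Type*} [Fintype n] [DecidableEq n] {c : ℝ}
    (hc : 0 < c) {A B : Matrix n n ℝ} (hA : A.PosDef) (hB : B.PosSemidef) :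
    (c⁻¹ • A + B)⁻¹ = c • (A + c • B)⁻¹ := by
  have hdet : IsUnit (A + c • B).det :=
    (Matrix.isUnit_iff_isUnit_det _).mp (hA.add_posSemidef (hB.smul hc.le)).isUnit
  apply Matrix.inv_eq_right_inv
  have h : c⁻¹ • A + B = c⁻¹ • (A + c • B) := by
    rw [smul_add, inv_smul_smul₀ hc.ne']
  rw [h, smul_mul_smul_comm, inv_mul_cancel₀ hc.ne', one_smul, Matrix.mul_nonsing_inv _ hdet]

theorem Hstack_transpose_mul_blockDiagonal_apply {d N : ℕ}
    (M : Fin N → Matrix (Fin d) (Fin d) ℝ) (k l : Fin d) (i : Fin N) :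
    ((Hstack d N)ᵀ * blockDiagonal M) k (l, i) = M i k l := by
  simp [Matrix.mul_apply, Hstack, blockDiagonal_apply, Fintype.sum_prod_type]

theorem Hstack_transpose_mul_blockDiagonal_mul_Hstack {d N : ℕ}
    (M : Fin N → Matrix (Fin d) (Fin d) ℝ) :
    (Hstack d N)ᵀ * blockDiagonal M * Hstack d N = ∑ i, M i := by
  ext k l
  rw [Matrix.mul_apply, Fintype.sum_prod_type, Finset.sum_comm, Matrix.sum_apply]
  simp [Hstack_transpose_mul_blockDiagonal_apply, Hstack]

/-- When the known component of the centralized covariance is block diagonal, the ESCI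
information matrix, gains and bound coincide with those of the SCI fusion. -/
theorem ESCI_eq_SCI_of_blockDiagonal {d N : ℕ} (hd : 1 ≤ d) (hN : 1 ≤ N)
    (ω : Fin N → ℝ) (hω : ∀ i, 0 < ω i)
    (P1 : Fin N → Matrix (Fin d) (Fin d) ℝ) (hP1 : ∀ i, (P1 i).PosDef)
    (P2 : Fin N → Matrix (Fin d) (Fin d) ℝ) (hP2 : ∀ i, (P2 i).PosSemidef) :
    let Bcent := Matrix.blockDiagonal (fun i => (ω i)⁻¹ • P1 i) +
      Matrix.blockDiagonal P2
    (Hstack d N)ᵀ * Bcent⁻¹ * Hstack d N = ∑ i, ω i • (P1 i + ω i • P2 i)⁻¹ ∧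
    (∀ (i : Fin N) (k l : Fin d),
      ((Hstack d N)ᵀ * Bcent⁻¹) k (l, i) = (ω i • (P1 i + ω i • P2 i)⁻¹) k l) ∧
    ((Hstack d N)ᵀ * Bcent⁻¹ * Hstack d N)⁻¹ = (∑ i, ω i • (P1 i + ω i • P2 i)⁻¹)⁻¹ ∧
    ∀ (i : Fin N) (k l : Fin d),
      (((Hstack d N)ᵀ * Bcent⁻¹ * Hstack d N)⁻¹ * ((Hstack d N)ᵀ * Bcent⁻¹)) k (l, i) =
        ((∑ j, ω j • (P1 j + ω j • P2 j)⁻¹)⁻¹ * (ω i • (P1 i + ω i • P2 i)⁻¹)) k l := by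
  intro Bcent
  have hB : Bcent⁻¹ = blockDiagonal (fun i => ω i • (P1 i + ω i • P2 i)⁻¹) := by
    have hadd : Bcent = blockDiagonal (fun i => (ω i)⁻¹ • P1 i + P2 i) :=
      (blockDiagonal_add _ _).symm
    rw [hadd, inv_blockDiagonal_of_isUnit_det]
    · simp only [(hP1 _).inv_inv_smul_add (hω _) (hP2 _)]
    · intro i
      exact (Matrix.isUnit_iff_isUnit_det _).mp
        (((hP1 i).smul (inv_pos.mpr (hω i))).add_posSemidef (hP2 i)).isUnit
  have hinfo : (Hstack d N)ᵀ * Bcent⁻¹ * Hstack d N = ∑ i, ω i • (P1 i + ω i • P2 i)⁻¹ := by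
    rw [hB, Hstack_transpose_mul_blockDiagonal_mul_Hstack]
  have hblock (i : Fin N) (k l : Fin d) :
      ((Hstack d N)ᵀ * Bcent⁻¹) k (l, i) = (ω i • (P1 i + ω i • P2 i)⁻¹) k l := by
    rw [hB, Hstack_transpose_mul_blockDiagonal_apply]
  refine ⟨hinfo, hblock, by rw [hinfo], fun i k l => ?_⟩
  rw [hinfo, Matrix.mul_apply, Matrix.mul_apply]
  simp only [hblock]
end

section
/- ESCI bound in the presence of a common noise (Woodbury identity for the fused information matrix). Let ω ∈ R^N have ω_i > 0 for all i, let q ≥ 1, let P'_1, …, P'_N be positive definite d × d matrices, let Q be a positive definite q × q matrix, and let M_1, …, M_N be d × q matrices with M_cent ∈ R^{Nd × q} their vertical stack. Set B_cent = diag(ω_1^{-1} P'_1, …, ω_N^{-1} P'_N) + M_cent Q M_centᵀ, S_0 = ∑_{i=1}^N ω_i M_iᵀ P'_i^{-1} M_i + Q^{-1}, and S_1 = ∑_{i=1}^N ω_i P'_i^{-1} M_i. Then B_cent is positive definite, S_0 is positive definite, and Hᵀ B_cent^{-1} H = ∑_{i=1}^N ω_i P'_i^{-1} − S_1 S_0^{-1}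 S_1ᵀ. -/
open Matrix

/-- The vertical stack of a family of matrices. -/
def vstack {ι m n : Type*} (U : ι → Matrix m n ℝ) : Matrix (m × ι) n ℝ :=
  fun p j => U p.2 p.1 j

theorem vstack_transpose_mul_blockDiagonal_mul_vstack {ι m n k l : Type*}
    [Fintype ι] [DecidableEq ι] [Fintype m] [Fintype n]
    (U : ι → Matrix m k ℝ) (A : ι → Matrix m n ℝ) (V : ι → Matrix n l ℝ) :
    (vstack U)ᵀ * blockDiagonal A * vstack V = ∑ i, (U i)ᵀ * A i * V i := by
  ext a b
  simp only [mul_apply, Matrix.sum_apply, transpose_apply, blockDiagonal_apply, vstack,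
    Fintype.sum_prod_type, mul_ite, mul_zero, Finset.sum_ite_eq', Finset.mem_univ, if_true]
  exact Finset.sum_comm

theorem posDef_blockDiagonal {ι m : Type*} [Fintype ι] [DecidableEq ι] [Fintype m]
    {A : ι → Matrix m m ℝ} (hA : ∀ i, (A i).PosDef) : (blockDiagonal A).PosDef := by
  refine PosDef.of_dotProduct_mulVec_pos ?_ fun x hx => ?_
  · rw [IsHermitian, blockDiagonal_conjTranspose]
    exact congrArg blockDiagonal (funext fun i => (hA i).isHermitian)
  · have h : star x ⬝ᵥ (blockDiagonal A *ᵥ x) =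
        ∑ i, star (fun a => x (a, i)) ⬝ᵥ (A i *ᵥ fun a => x (a, i)) := by
      simp only [dotProduct, mulVec, blockDiagonal_apply, Fintype.sum_prod_type, ite_mul,
        zero_mul, Finset.sum_ite_eq, Finset.mem_univ, if_true, Pi.star_apply]
      exact Finset.sum_comm
    obtain ⟨⟨a, i⟩, hai⟩ := Function.ne_iff.mp hx
    rw [h]
    exact Finset.sum_pos' (fun j _ => (hA j).posSemidef.dotProduct_mulVec_nonneg _)
      ⟨i, Finset.mem_univ i, (hA i).dotProduct_mulVec_pos fun h0 => hai (congrFun h0 a)⟩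

theorem inv_blockDiagonal {ι m : Type*} [Fintype ι] [DecidableEq ι] [Fintype m]
    [DecidableEq m] {A : ι → Matrix m m ℝ} (hA : ∀ i, IsUnit (A i)) :
    (blockDiagonal A)⁻¹ = blockDiagonal fun i => (A i)⁻¹ := by
  refine inv_eq_right_inv ?_
  rw [← blockDiagonal_mul, ← blockDiagonal_one]
  exact congrArg blockDiagonal
    (funext fun i => mul_nonsing_inv _ ((isUnit_iff_isUnit_det _).mp (hA i)))

/-- ESCI bound in the presence of a common noise: Woodbury identity for the fused
information matrix. -/
theorem ESCI_commonNoise_bound {d N q : ℕ} (hd : 1 ≤ d) (hN : 1 ≤ N) (hq : 1 ≤ q)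
    (ω : Fin N → ℝ) (hω : ∀ i, 0 < ω i)
    (P' : Fin N → Matrix (Fin d) (Fin d) ℝ) (hP' : ∀ i, (P' i).PosDef)
    (Q : Matrix (Fin q) (Fin q) ℝ) (hQ : Q.PosDef)
    (M : Fin N → Matrix (Fin d) (Fin q) ℝ) :
    let Mcent : Matrix (Fin d × Fin N) (Fin q) ℝ := fun p j => M p.2 p.1 j
    let Bcent := Matrix.blockDiagonal (fun i => (ω i)⁻¹ • P' i) + Mcent * Q * Mcentᵀ
    let S0 := (∑ i, ω i • ((M i)ᵀ * (P' i)⁻¹ * M i)) + Q⁻¹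
    let S1 := ∑ i, ω i • ((P' i)⁻¹ * M i)
    Bcent.PosDef ∧ S0.PosDef ∧
    (Hstack d N)ᵀ * Bcent⁻¹ * Hstack d N = (∑ i, ω i • (P' i)⁻¹) - S1 * S0⁻¹ * S1ᵀ := by
  intro Mcent Bcent S0 S1
  have hA : ∀ i, ((ω i)⁻¹ • P' i).PosDef := fun i => (hP' i).smul (inv_pos.mpr (hω i))
  have hD := posDef_blockDiagonal hA
  have hDinv : (blockDiagonal fun i => (ω i)⁻¹ • P' i)⁻¹ =
      blockDiagonal fun i => ω i • (P' i)⁻¹ := by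
    rw [inv_blockDiagonal fun i => (hA i).isUnit]
    refine congrArg blockDiagonal (funext fun i => inv_eq_right_inv ?_)
    rw [smul_mul_smul_comm, inv_mul_cancel₀ (hω i).ne', one_smul,
      mul_nonsing_inv _ ((isUnit_iff_isUnit_det _).mp (hP' i).isUnit)]
  have hM : Mcent = vstack M := rfl
  have hH : Hstack d N = vstack fun _ => 1 := rfl
  have hB : Bcent.PosDef := hD.add_posSemidef (by
    simpa using hQ.posSemidef.mul_mul_conjTranspose_same Mcent)
  have hS0_eq : S0 = Q⁻¹ + Mcentᵀ * (blockDiagonal fun i => (ω i)⁻¹ • P' i)⁻¹ * Mcent := by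
    rw [hDinv, hM, vstack_transpose_mul_blockDiagonal_mul_vstack, add_comm]
    simp [S0]
  have hS0 : S0.PosDef := by
    rw [hS0_eq]
    exact hQ.inv.add_posSemidef (by
      simpa using hD.inv.posSemidef.conjTranspose_mul_mul_same Mcent)
  refine ⟨hB, hS0, ?_⟩
  have hHM : (Hstack d N)ᵀ * (blockDiagonal fun i => (ω i)⁻¹ • P' i)⁻¹ * Mcent = S1 := by
    rw [hDinv, hM, hH, vstack_transpose_mul_blockDiagonal_mul_vstack]
    simp [S1]
  have hHH : (Hstack d N)ᵀ * (blockDiagonal fun i => (ω i)⁻¹ • P' i)⁻¹ * Hstack d N =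
      ∑ i, ω i • (P' i)⁻¹ := by
    rw [hDinv, hH, vstack_transpose_mul_blockDiagonal_mul_vstack]
    simp
  have hMH : Mcentᵀ * (blockDiagonal fun i => (ω i)⁻¹ • P' i)⁻¹ * Hstack d N = S1ᵀ := by
    have hsymm : ((blockDiagonal fun i => (ω i)⁻¹ • P' i)⁻¹)ᵀ =
        (blockDiagonal fun i => (ω i)⁻¹ • P' i)⁻¹ := by
      simpa [IsHermitian] using hD.inv.isHermitian
    rw [← hHM, transpose_mul, transpose_mul, transpose_transpose, hsymm, Matrix.mul_assoc]
  have hwoodbury := add_mul_mul_inv_eq_sub _ Mcent Q Mcentᵀ hD.isUnit hQ.isUnit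
    (hS0_eq ▸ hS0.isUnit)
  rw [← hS0_eq] at hwoodbury
  rw [show Bcent⁻¹ = _ from hwoodbury, ← hHH, ← hMH, ← hHM]
  simp only [Matrix.mul_sub, Matrix.sub_mul, Matrix.mul_assoc]
end

section
/- ESCI gain in the presence of a common noise. Under the same data as in the Woodbury identity — ω ∈ R^N with ω_i > 0, P'_1, …, P'_N positive definite d × d matrices, Q positive definite q × q, M_i ∈ R^{d × q} with vertical stack M_cent, B_cent = diag(ω_1^{-1} P'_1, …, ω_N^{-1} P'_N) + M_cent Q M_centᵀ, S_0 = ∑_i ω_i M_iᵀ P'_i^{-1} M_i + Q^{-1}, S_1 = ∑_i ω_i P'_i^{-1} M_i — the i-th d × d block of the d × Nd matrix Hᵀ B_cent^{-1} equals ω_i (I_d − S_1 S_0^{-1} M_iᵀ) P'_i^{-1}, for every i = 1, …, N. -/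
open Matrix

/-- The vertical stack of a family of matrices. -/
def blockColumn {ι m n R : Type*} (F : ι → Matrix m n R) : Matrix (m × ι) n R :=
  fun p j => F p.2 p.1 j

section blockColumn

variable {ι m n l : Type*} [Fintype ι] [Fintype m] {R : Type*} [CommSemiring R]

theorem blockColumn_transpose_mul (F : ι → Matrix m n R) (G : ι → Matrix m l R) :
    (blockColumn F)ᵀ * blockColumn G = ∑ i, (F i)ᵀ * G i := by
  ext a b
  simp only [mul_apply, Matrix.sum_apply, transpose_apply, blockColumn, Fintype.sum_prod_type_right]

theorem blockColumn_transpose_mul_blockDiagonal [DecidableEq ι] (F : ι → Matrix m n R)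
    (D : ι → Matrix m m R) :
    (blockColumn F)ᵀ * blockDiagonal D = (blockColumn fun i => (D i)ᵀ * F i)ᵀ := by
  ext a ⟨b, i⟩
  simp [mul_apply, blockColumn, Fintype.sum_prod_type_right, blockDiagonal_apply, mul_comm]

end blockColumn

theorem isUnit_blockDiagonal_and_inv {ι m : Type*} [Fintype ι] [DecidableEq ι] [Fintype m]
    [DecidableEq m] {R : Type*} [CommRing R] {A D : ι → Matrix m m R} (h : ∀ i, A i * D i = 1) :
    IsUnit (blockDiagonal A) ∧ (blockDiagonal A)⁻¹ = blockDiagonal D := by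
  have hAD : blockDiagonal A * blockDiagonal D = 1 := by
    rw [← blockDiagonal_mul, funext h, ← blockDiagonal_one]
    rfl
  exact ⟨IsUnit.of_mul_eq_one _ hAD, inv_eq_right_inv hAD⟩

/-- ESCI gain in the presence of a common noise: blockwise form of `Hᵀ B_cent⁻¹`. -/
theorem ESCI_commonNoise_gain {d N q : ℕ} (hd : 1 ≤ d) (hN : 1 ≤ N) (hq : 1 ≤ q)
    (ω : Fin N → ℝ) (hω : ∀ i, 0 < ω i)
    (P' : Fin N → Matrix (Fin d) (Fin d) ℝ) (hP' : ∀ i, (P' i).PosDef)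
    (Q : Matrix (Fin q) (Fin q) ℝ) (hQ : Q.PosDef)
    (M : Fin N → Matrix (Fin d) (Fin q) ℝ) :
    let Mcent : Matrix (Fin d × Fin N) (Fin q) ℝ := fun p j => M p.2 p.1 j
    let Bcent := Matrix.blockDiagonal (fun i => (ω i)⁻¹ • P' i) + Mcent * Q * Mcentᵀ
    let S0 := (∑ i, ω i • ((M i)ᵀ * (P' i)⁻¹ * M i)) + Q⁻¹
    let S1 := ∑ i, ω i • ((P' i)⁻¹ * M i)
    ∀ (i : Fin N) (k l : Fin d),
      ((Hstack d N)ᵀ * Bcent⁻¹) k (l, i) =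
        (ω i • (((1 : Matrix (Fin d) (Fin d) ℝ) - S1 * S0⁻¹ * (M i)ᵀ) * (P' i)⁻¹)) k l := by
  intro Mcent Bcent S0 S1 i k l
  set D : Fin N → Matrix (Fin d) (Fin d) ℝ := fun i => ω i • (P' i)⁻¹ with hD
  have hM : Mcent = blockColumn M := rfl
  have hH : Hstack d N = blockColumn fun _ => 1 := rfl
  obtain ⟨hA, hAinv⟩ := isUnit_blockDiagonal_and_inv
    (A := fun i => (ω i)⁻¹ • P' i) (D := D) fun i => by
      simp [hD, smul_smul, (hω i).ne',
        mul_nonsing_inv _ ((isUnit_iff_isUnit_det _).1 (hP' i).isUnit)]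
  have hS0 : Q⁻¹ + Mcentᵀ * (blockDiagonal fun i => (ω i)⁻¹ • P' i)⁻¹ * Mcent = S0 := by
    rw [hAinv, hM, blockColumn_transpose_mul_blockDiagonal, blockColumn_transpose_mul, add_comm]
    simp [S0, hD, Matrix.mul_assoc]
  have hS1 : (Hstack d N)ᵀ * blockDiagonal D * Mcent = S1 := by
    rw [hH, hM, blockColumn_transpose_mul_blockDiagonal, blockColumn_transpose_mul]
    simp [S1, hD]
  have hS0_unit : IsUnit S0 := by
    refine (PosDef.posSemidef_add (posSemidef_sum _ fun i _ => ?_) hQ.inv).isUnit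
    simpa using ((hP' i).inv.posSemidef.conjTranspose_mul_mul_same (M i)).smul (hω i).le
  have hB : (Hstack d N)ᵀ * Bcent⁻¹ =
      (Hstack d N)ᵀ * blockDiagonal D - S1 * S0⁻¹ * (Mcentᵀ * blockDiagonal D) := by
    rw [add_mul_mul_inv_eq_sub _ _ _ _ hA hQ.isUnit (by rwa [hS0]), hS0, hAinv, ← hS1]
    simp only [Matrix.mul_sub, Matrix.mul_assoc]
  have hi : ω i • ((1 - S1 * S0⁻¹ * (M i)ᵀ) * (P' i)⁻¹) =
      D i - S1 * S0⁻¹ * ((M i)ᵀ * D i) := by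
    simp [hD, Matrix.sub_mul, smul_sub, Matrix.mul_assoc]
  have hblock : (M i)ᵀ * D i = ((D i)ᵀ * M i)ᵀ := by simp
  rw [hB, hi, hblock, hH, hM, blockColumn_transpose_mul_blockDiagonal,
    blockColumn_transpose_mul_blockDiagonal]
  refine congrArg₂ (fun x y : ℝ => x - y) ?_ rfl
  simp [blockColumn]
end

section
/- ESCI with an additive common noise. Let ω ∈ R^N have ω_i > 0 for all i, let P'_1, …, P'_N be positive definite d × d matrices, and let Q be a positive definite d × d matrix. Set B_cent = diag(ω_1^{-1} P'_1, …, ω_N^{-1} P'_N) + H Q Hᵀ and B_0 = (∑_{i=1}^N ω_i P'_i^{-1})^{-1}. Then (Hᵀ B_cent^{-1} H)^{-1} = B_0 + Q, and for every i the i-th d × d block of the gain (Hᵀ B_cent^{-1} H)^{-1} Hᵀ B_cent^{-1} equals B_0 ω_i P'_i^{-1}. -/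
open Matrix

section Woodbury

variable {m n R : Type*} [Fintype m] [DecidableEq m] [Fintype n] [DecidableEq n] [CommRing R]

theorem Matrix.isUnit_add_mul_mul {A : Matrix n n R} {U : Matrix n m R} {C : Matrix m m R}
    {V : Matrix m n R} (hA : IsUnit A) (hC : IsUnit C) (hAC : IsUnit (C⁻¹ + V * A⁻¹ * U)) :
    IsUnit (A + U * C * V) := by
  obtain ⟨_⟩ := hA.nonempty_invertible
  obtain ⟨_⟩ := hC.nonempty_invertible
  obtain ⟨iAC⟩ := hAC.nonempty_invertible
  simp only [← invOf_eq_nonsing_inv] at iAC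
  let := invertibleAddMulMul A U C V
  exact isUnit_of_invertible _

/-- If `S = V * A⁻¹ * U` is invertible, then `S⁻¹ + C` carries `V * (A + U * C * V)⁻¹` to
`S⁻¹ * V * A⁻¹`. -/
theorem Matrix.inv_add_mul_mul_inv_add_mul_mul {A : Matrix n n R} {U : Matrix n m R}
    {C : Matrix m m R} {V : Matrix m n R} (hA : IsUnit A) (hS : IsUnit (V * A⁻¹ * U))
    (hB : IsUnit (A + U * C * V)) :
    ((V * A⁻¹ * U)⁻¹ + C) * (V * (A + U * C * V)⁻¹) = (V * A⁻¹ * U)⁻¹ * (V * A⁻¹) := by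
  rw [isUnit_iff_isUnit_det] at hA hS hB
  have h : (V * A⁻¹ * U)⁻¹ * (V * A⁻¹) * (A + U * C * V) = ((V * A⁻¹ * U)⁻¹ + C) * V := by
    calc _ = (V * A⁻¹ * U)⁻¹ * (V * (A⁻¹ * A)) +
          ((V * A⁻¹ * U)⁻¹ * (V * A⁻¹ * U)) * (C * V) := by
          simp only [Matrix.mul_add, Matrix.mul_assoc]
      _ = _ := by
          rw [nonsing_inv_mul _ hA, nonsing_inv_mul _ hS, Matrix.mul_one, Matrix.one_mul,
            Matrix.add_mul]
  rw [← Matrix.mul_assoc, ← h, mul_nonsing_inv_cancel_right _ _ hB]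

/-- Adding `U * C * V` to `A` adds `C` to `(V * A⁻¹ * U)⁻¹`. -/
theorem Matrix.inv_mul_inv_add_mul_mul_mul {A : Matrix n n R} {U : Matrix n m R}
    {C : Matrix m m R} {V : Matrix m n R} (hA : IsUnit A) (hS : IsUnit (V * A⁻¹ * U))
    (hB : IsUnit (A + U * C * V)) :
    (V * (A + U * C * V)⁻¹ * U)⁻¹ = (V * A⁻¹ * U)⁻¹ + C := by
  refine inv_eq_left_inv ?_
  rw [← Matrix.mul_assoc, inv_add_mul_mul_inv_add_mul_mul hA hS hB, Matrix.mul_assoc,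
    nonsing_inv_mul _ ((isUnit_iff_isUnit_det _).1 hS)]

end Woodbury

/-- ESCI with an additive common noise: the fused bound is `B₀ + Q` and the gain blocks are
`B₀ ω_i P'_i⁻¹`. -/
theorem ESCI_additiveNoise {d N : ℕ} (hd : 1 ≤ d) (hN : 1 ≤ N)
    (ω : Fin N → ℝ) (hω : ∀ i, 0 < ω i)
    (P' : Fin N → Matrix (Fin d) (Fin d) ℝ) (hP' : ∀ i, (P' i).PosDef)
    (Q : Matrix (Fin d) (Fin d) ℝ) (hQ : Q.PosDef) :
    let Bcent := Matrix.blockDiagonal (fun i => (ω i)⁻¹ • P' i) +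
      Hstack d N * Q * (Hstack d N)ᵀ
    let B0 := (∑ i, ω i • (P' i)⁻¹)⁻¹
    ((Hstack d N)ᵀ * Bcent⁻¹ * Hstack d N)⁻¹ = B0 + Q ∧
    ∀ (i : Fin N) (k l : Fin d),
      (((Hstack d N)ᵀ * Bcent⁻¹ * Hstack d N)⁻¹ * ((Hstack d N)ᵀ * Bcent⁻¹)) k (l, i) =
        (ω i • (B0 * (P' i)⁻¹)) k l := by
  intro Bcent B0
  have : NeZero N := ⟨by omega⟩
  set D := blockDiagonal fun i => (ω i)⁻¹ • P' i with hD
  set E := blockDiagonal fun i => ω i • (P' i)⁻¹ with hE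
  have hDE : D * E = 1 := by
    rw [hD, hE, ← blockDiagonal_mul, ← blockDiagonal_one]
    congr 1
    funext i
    simp [mul_nonsing_inv _ ((isUnit_iff_isUnit_det _).1 (hP' i).isUnit), smul_smul,
      (hω i).ne']
  have hDinv : D⁻¹ = E := inv_eq_right_inv hDE
  have hDunit : IsUnit D := IsUnit.of_mul_eq_one E hDE
  have hS : (Hstack d N)ᵀ * D⁻¹ * Hstack d N = ∑ i, ω i • (P' i)⁻¹ := by
    rw [hDinv, hE, Hstack_transpose_mul_blockDiagonal_mul_Hstack]
  have hSpos : ((Hstack d N)ᵀ * D⁻¹ * Hstack d N).PosDef := by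
    rw [hS]
    exact posDef_sum Finset.univ_nonempty fun i _ => (hP' i).inv.smul (hω i)
  have hB : IsUnit (D + Hstack d N * Q * (Hstack d N)ᵀ) :=
    isUnit_add_mul_mul hDunit hQ.isUnit (hQ.inv.add hSpos).isUnit
  have hcov : ((Hstack d N)ᵀ * Bcent⁻¹ * Hstack d N)⁻¹ = B0 + Q := by
    simpa only [hS] using inv_mul_inv_add_mul_mul_mul hDunit hSpos.isUnit hB
  have hgain : (B0 + Q) * ((Hstack d N)ᵀ * Bcent⁻¹) = B0 * ((Hstack d N)ᵀ * E) := by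
    have h := inv_add_mul_mul_inv_add_mul_mul hDunit hSpos.isUnit hB
    rwa [hS, hDinv] at h
  refine ⟨hcov, fun i k l => ?_⟩
  rw [hcov, hgain, ← Matrix.mul_smul, Matrix.mul_apply, Matrix.mul_apply]
  simp only [hE, Hstack_transpose_mul_blockDiagonal_apply]
end

section
/- Conservativeness of the (information-form) measurement update. Let P be a positive definite d × d matrix, S a positive semidefinite d × d matrix, and set P' = (P^{-1} + S)^{-1}. Then for every positive semidefinite d × d matrix Σ with Σ ⪯ P, one has P' P^{-1} Σ P^{-1} P' + P' S P' ⪯ P'. In particular, if Σ is the true covariance of an estimation error bounded by P, and the estimate is updated with an independent measurement of information matrix S = H_obsᵀ R^{-1} H_obs (R positive definite), then the updated error covariance is bounded by the updated bound P'. -/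
open Matrix

/-- Conservativeness of the information-form measurement update. -/
theorem update_conservative {d : ℕ} (hd : 1 ≤ d)
    (P : Matrix (Fin d) (Fin d) ℝ) (hP : P.PosDef)
    (S : Matrix (Fin d) (Fin d) ℝ) (hS : S.PosSemidef) :
    let P' := (P⁻¹ + S)⁻¹
    ∀ Sig : Matrix (Fin d) (Fin d) ℝ, Sig.PosSemidef → (P - Sig).PosSemidef →
      (P' - (P' * P⁻¹ * Sig * P⁻¹ * P' + P' * S * P')).PosSemidef := by
  intro P' Sig _ hle
  have hM : (P⁻¹ + S).PosDef := hP.inv.add_posSemidef hS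
  have hP' : P'ᴴ = P' := hM.inv.isHermitian
  have hPinv : (P⁻¹)ᴴ = P⁻¹ := hP.inv.isHermitian
  have hcancel : P' * (P⁻¹ + S) = 1 :=
    nonsing_inv_mul _ ((isUnit_iff_isUnit_det _).mp hM.isUnit)
  have hPP : P⁻¹ * P = 1 := nonsing_inv_mul _ ((isUnit_iff_isUnit_det _).mp hP.isUnit)
  have hsplit : P' = P' * P⁻¹ * P' + P' * S * P' := by
    rw [← add_mul, ← mul_add, hcancel, one_mul]
  have hcongr : P' - (P' * P⁻¹ * Sig * P⁻¹ * P' + P' * S * P')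
      = (P' * P⁻¹) * (P - Sig) * (P' * P⁻¹)ᴴ := by
    have hfactor : (P' * P⁻¹) * (P - Sig) * (P' * P⁻¹)ᴴ
        = P' * P⁻¹ * P' - P' * P⁻¹ * Sig * P⁻¹ * P' := by
      rw [conjTranspose_mul, hP', hPinv, mul_sub, sub_mul, mul_assoc P' P⁻¹ P, hPP, mul_one]
      simp only [mul_assoc]
    rw [hfactor, sub_add_eq_sub_sub_swap, sub_left_inj, sub_eq_iff_eq_add]
    exact hsplit
  rw [hcongr]
  exact hle.mul_mul_conjTranspose_same _
end
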